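/- Let x > 2 and y be positive integers with y·(x − 2) > 2x² + 2x + 1. Then there exists an integer N such that for every v ≥ N with v ≡ 1 or −1 (mod xy), every multiset of size v − 1 whose support is {1, x, y} is realizable. -/

import Mathlib

/-- The multiset of absolute differences of consecutive entries of a list of naturals. -/
def linDiffs (l : List ℕ) : Multiset ℕ :=
  ↑(List.zipWith (fun a b => (a - b) + (b - a)) l l.tail)

/-- `l` is a linear realization of the multiset `L`: it lists `0, …, |L|`
(each exactly once) and its consecutive absolute differences form `L`. -/
def IsLinearRealization (L : Multiset ℕ) (l : List ℕ) : Prop :=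
  l.Perm (List.range (Multiset.card L + 1)) ∧ linDiffs l = L

def HasLinearRealization (L : Multiset ℕ) : Prop :=
  ∃ l : List ℕ, IsLinearRealization L l

/-- A standard linear realization starts at `0`. -/
def HasStandardLinearRealization (L : Multiset ℕ) : Prop :=
  ∃ l : List ℕ, IsLinearRealization L l ∧ l.head? = some 0

/-- A perfect linear realization starts at `0` and ends at `v - 1 = |L|`. -/
def HasPerfectLinearRealization (L : Multiset ℕ) : Prop :=
  ∃ l : List ℕ, IsLinearRealization L l ∧ l.head? = some 0 ∧
    l.getLast? = some (Multiset.card L)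

/-- The multiset of cyclic edge-lengths `min(|gᵢ₊₁ - gᵢ|, v - |gᵢ₊₁ - gᵢ|)`
of consecutive entries of a list of naturals. -/
def cycDiffs (v : ℕ) (l : List ℕ) : Multiset ℕ :=
  ↑(List.zipWith (fun a b => min ((a - b) + (b - a)) (v - ((a - b) + (b - a)))) l l.tail)

/-- `L` is (cyclically) realizable in `K_v`: some Hamiltonian path on the vertex
set `{0, …, v-1}` has `L` as its multiset of edge-lengths. -/
def IsRealizable (v : ℕ) (L : Multiset ℕ) : Prop :=
  ∃ l : List ℕ, l.Perm (List.range v) ∧ cycDiffs v l = L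

/-- The multiset `{1^a, x^b, y^c}`. -/
def mset3 (a b c x y : ℕ) : Multiset ℕ :=
  Multiset.replicate a 1 + Multiset.replicate b x + Multiset.replicate c y

/-- With `b = q'x + r'`, `0 ≤ r' < x`: `ω(x,b) = x - 1` if `q' = 0`, `r' = 1`,
or at least one of `x`, `r'` is even; otherwise `ω(x,b) = x`. -/
def omegaBHR (x b : ℕ) : ℕ :=
  if b / x = 0 ∨ b % x = 1 ∨ Even x ∨ Even (b % x) then x - 1 else x

/-- The reduced form `ĝ = min(g, v - g)`. -/
def reducedForm (v g : ℕ) : ℕ := min g (v - g)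

/-- The function `f` of Theorem 3.7 (counterexample characterization refined). -/
def fBHR (u w : ℕ) : ℕ :=
  if Even u ∧ Even w then w - 1
  else if u = 3 ∨ (Even u ∧ ¬ Even w) then u + w - 2
  else u + w - 1

/-- A multiset `L` of size `v - 1` with elements in `{1, …, ⌊v/2⌋}` is admissible
if for every divisor `d` of `v` the number of elements of `L` divisible by `d`
is at most `v - d`. -/
def IsAdmissible (v : ℕ) (L : Multiset ℕ) : Prop :=
  Multiset.card L = v - 1 ∧ (∀ z ∈ L, 1 ≤ z ∧ z ≤ v / 2) ∧
  ∀ d : ℕ, d ∣ v → Multiset.card (L.filter (fun z => d ∣ z)) ≤ v - d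

lemma linDiffs_cons_cons (a b : ℕ) (l : List ℕ) :
    linDiffs (a :: b :: l) = ((a - b) + (b - a)) ::ₘ linDiffs (b :: l) := by
  simp [linDiffs]

lemma linDiffs_singleton (a : ℕ) : linDiffs [a] = 0 := by
  simp [linDiffs]

lemma linDiffs_append {l l' : List ℕ} {w u : ℕ} (hw : l.getLast? = some w)
    (hu : l'.head? = some u) :
    linDiffs (l ++ l') = linDiffs l + linDiffs l' + {(w - u) + (u - w)} := by
  obtain ⟨t, rfl⟩ : ∃ t, l' = u :: t := by
    cases l' with
    | nil => simp at hu
    | cons a t => exact ⟨t, by simpa using hu⟩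
  induction l with
  | nil => simp at hw
  | cons a l ih =>
    cases l with
    | nil =>
      obtain rfl : a = w := by simpa using hw
      rw [List.singleton_append, linDiffs_cons_cons, linDiffs_singleton, zero_add,
        Multiset.add_comm, Multiset.singleton_add]
    | cons b l =>
      have := ih (by simpa using hw)
      rw [List.cons_append, List.cons_append, linDiffs_cons_cons, linDiffs_cons_cons,
        ← List.cons_append, this]
      simp only [Multiset.cons_add]

lemma linDiffs_reverse (l : List ℕ) : linDiffs l.reverse = linDiffs l := by
  induction l with
  | nil => rfl
  | cons a l ih =>
    cases l with
    | nil => rfl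
    | cons b l =>
      rw [List.reverse_cons, linDiffs_append (w := b) (u := a) (by simp) (by simp), ih,
        linDiffs_cons_cons, linDiffs_singleton, add_zero, Multiset.add_comm,
        Multiset.singleton_add, Nat.add_comm]

lemma linDiffs_map_of_isometry {f : ℕ → ℕ} {l : List ℕ}
    (hf : ∀ a ∈ l, ∀ b ∈ l, (f a - f b) + (f b - f a) = (a - b) + (b - a)) :
    linDiffs (l.map f) = linDiffs l := by
  induction l with
  | nil => rfl
  | cons a l ih =>
    cases l with
    | nil => rfl
    | cons b l =>
      have := ih fun c hc d hd => hf c (by simp [hc]) d (by simp [hd])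
      rw [List.map_cons, List.map_cons, linDiffs_cons_cons, linDiffs_cons_cons,
        ← List.map_cons, this, hf a (by simp) b (by simp)]

lemma card_linDiffs (l : List ℕ) : Multiset.card (linDiffs l) = l.length - 1 := by
  simp [linDiffs]

/-- There is a path from `u` to `w` visiting exactly the cells `(i, t)` with `P i t`, where the
cell `(i, t)` stands for the number `i + x * t`, using `s` edges of length `1` and all other
edges of length `x`. -/
def HasGridPath (x s : ℕ) (P : ℕ → ℕ → Prop) (u w : ℕ × ℕ) : Prop :=
  ∃ (l : List (ℕ × ℕ)) (b : ℕ), l.Nodup ∧ (∀ i t, (i, t) ∈ l ↔ P i t) ∧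
    l.head? = some u ∧ l.getLast? = some w ∧
    linDiffs (l.map fun p => p.1 + x * p.2) = Multiset.replicate s 1 + Multiset.replicate b x

namespace HasGridPath

variable {x s s' : ℕ} {P Q R : ℕ → ℕ → Prop} {u w u' w' : ℕ × ℕ}

lemma reverse (h : HasGridPath x s P u w) : HasGridPath x s P w u := by
  obtain ⟨l, b, h1, h2, h3, h4, h5⟩ := h
  exact ⟨l.reverse, b, by simpa, by simpa, by simpa, by simpa,
    by rw [List.map_reverse, linDiffs_reverse, h5]⟩

lemma congr (h : HasGridPath x s P u w) (hPQ : ∀ i t, Q i t ↔ P i t) :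
    HasGridPath x s Q u w := by
  obtain ⟨l, b, h1, h2, h3⟩ := h
  exact ⟨l, b, h1, fun i t => (h2 i t).trans (hPQ i t).symm, h3⟩

lemma append_aux (h : HasGridPath x s P u w) (h' : HasGridPath x s' Q u' w')
    (hPQ : ∀ i t, P i t → ¬ Q i t) (hR : ∀ i t, R i t ↔ P i t ∨ Q i t) {e b' s'' : ℕ}
    (he : (w.1 + x * w.2 - (u'.1 + x * u'.2)) + (u'.1 + x * u'.2 - (w.1 + x * w.2)) = e)
    (hs : Multiset.replicate (s + s') 1 + {e} =
      Multiset.replicate s'' 1 + Multiset.replicate b' x) :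
    HasGridPath x s'' R u w' := by
  obtain ⟨l, b, h1, h2, h3, h4, h5⟩ := h
  obtain ⟨m, c, k1, k2, k3, k4, k5⟩ := h'
  refine ⟨l ++ m, b + c + b', ?_, ?_, ?_, ?_, ?_⟩
  · refine List.Nodup.append h1 k1 ?_
    rintro ⟨i, t⟩ hl hm
    exact hPQ i t ((h2 i t).1 hl) ((k2 i t).1 hm)
  · intro i t
    rw [List.mem_append, h2, k2, hR]
  · simp [h3]
  · simp [k4]
  · rw [List.map_append, linDiffs_append (w := w.1 + x * w.2) (u := u'.1 + x * u'.2)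
      (by simp [h4]) (by simp [k3]), h5, k5, he]
    rw [Multiset.replicate_add, Multiset.replicate_add]
    rw [Multiset.replicate_add] at hs
    calc _ = (Multiset.replicate s 1 + Multiset.replicate s' 1 + {e}) +
          (Multiset.replicate b x + Multiset.replicate c x) := by abel
      _ = _ := by rw [hs]; abel

/-- Join two disjoint paths by an edge of length `1`. -/
lemma append (h : HasGridPath x s P u w) (h' : HasGridPath x s' Q u' w')
    (hPQ : ∀ i t, P i t → ¬ Q i t) (hR : ∀ i t, R i t ↔ P i t ∨ Q i t)
    (he : (w.1 + x * w.2) + 1 = u'.1 + x * u'.2 ∨ (u'.1 + x * u'.2) + 1 = w.1 + x * w.2)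
    {n : ℕ} (hn : n = s + s' + 1) : HasGridPath x n R u w' :=
  append_aux h h' hPQ hR (e := 1) (b' := 0) (by omega) (by
    rw [hn, Multiset.replicate_add (s + s') 1 1, Multiset.replicate_one, Multiset.replicate_zero,
      add_zero])

lemma column (x c t : ℕ) (n : ℕ) :
    HasGridPath x 0 (fun i j => i = c ∧ t ≤ j ∧ j ≤ t + n) (c, t) (c, t + n) := by
  induction n with
  | zero =>
    refine ⟨[(c, t)], 0, by simp, ?_, rfl, rfl, by simp [linDiffs_singleton]⟩
    intro i j
    simp only [List.mem_singleton, Prod.mk.injEq]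
    omega
  | succ n ih =>
    have hcell : HasGridPath x 0 (fun i j => i = c ∧ j = t + (n + 1)) (c, t + (n + 1))
        (c, t + (n + 1)) :=
      ⟨[(c, t + (n + 1))], 0, by simp, by simp, rfl, rfl, by simp [linDiffs_singleton]⟩
    refine append_aux ih hcell (e := x) (b' := 1) (by omega) (by omega) ?_ (by simp)
    have : x * (t + (n + 1)) = x * (t + n) + x := by ring
    simp only [this]
    omega

lemma column_up (x c : ℕ) {m n : ℕ} (h : m ≤ n) :
    HasGridPath x 0 (fun i j => i = c ∧ m ≤ j ∧ j ≤ n) (c, m) (c, n) := by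
  obtain ⟨k, rfl⟩ := Nat.exists_eq_add_of_le h
  exact column x c m k

lemma column_down (x c : ℕ) {m n : ℕ} (h : m ≤ n) :
    HasGridPath x 0 (fun i j => i = c ∧ m ≤ j ∧ j ≤ n) (c, n) (c, m) :=
  (column_up x c h).reverse

/-- Snake through an even number of columns whose heights agree in pairs. -/
lemma snake (x c p : ℕ) (h : ℕ → ℕ) (hh : ∀ j ≤ p, h (c + 2 * j + 1) = h (c + 2 * j)) :
    HasGridPath x (2 * p + 1) (fun i t => c ≤ i ∧ i < c + 2 * p + 2 ∧ t ≤ h i) (c, 0)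
      (c + 2 * p + 1, 0) := by
  have pair : ∀ j ≤ p, HasGridPath x 1
      (fun i t => c + 2 * j ≤ i ∧ i < c + 2 * j + 2 ∧ t ≤ h i) (c + 2 * j, 0)
      (c + 2 * j + 1, 0) := by
    intro j hj
    refine append (column_up x (c + 2 * j) (Nat.zero_le (h (c + 2 * j))))
      (column_down x (c + 2 * j + 1) (Nat.zero_le (h (c + 2 * j)))) (by omega) ?_ (by simp; omega) rfl
    intro i t
    have := hh j hj
    constructor
    · rintro ⟨h1, h2, h3⟩
      obtain rfl | rfl : i = c + 2 * j ∨ i = c + 2 * j + 1 := by omega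
      · omega
      · omega
    · rintro (⟨rfl, h2⟩ | ⟨rfl, h2⟩) <;> omega
  induction p with
  | zero => exact pair 0 le_rfl
  | succ p ih =>
    refine append (ih (fun j hj => hh j (by omega)) fun j hj => pair j (by omega))
      (pair (p + 1) le_rfl) (by omega) (by omega) (by simp; omega) (by omega)

end HasGridPath

/-- A grid path through `q + 1` full rows of length `x` and `r` further cells on top of them gives
a linear realization. -/
lemma HasGridPath.exists_standard {x s q r : ℕ} {w : ℕ × ℕ} (hr : r < x)
    (h : HasGridPath x s (fun i t => i < x ∧ t ≤ if i < r then q + 1 else q) (0, 0) w) {b : ℕ}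
    (hb : (q + 1) * x + r = s + b + 1) :
    ∃ l : List ℕ, l.Perm (List.range (s + b + 1)) ∧ l.head? = some 0 ∧
      linDiffs l = Multiset.replicate s 1 + Multiset.replicate b x := by
  obtain ⟨l, b', h1, h2, h3, h4, h5⟩ := h
  have hperm : (l.map fun p => p.1 + x * p.2).Perm (List.range (s + b + 1)) := by
    rw [List.perm_ext_iff_of_nodup _ List.nodup_range]
    · intro n
      rw [List.mem_map, List.mem_range]
      constructor
      · rintro ⟨⟨i, t⟩, hp, rfl⟩
        obtain ⟨hi, ht⟩ := (h2 i t).1 hp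
        rw [← hb]
        dsimp only
        split_ifs at ht with hir
        · nlinarith
        · nlinarith
      · intro hn
        refine ⟨(n % x, n / x), (h2 _ _).2 ⟨Nat.mod_lt _ (by omega), ?_⟩, Nat.mod_add_div n x⟩
        rw [← hb] at hn
        have hdiv := Nat.mod_add_div n x
        have hmod := Nat.zero_le (n % x)
        split_ifs with hir
        · by_contra! hc
          have := Nat.mul_le_mul_left x (Nat.succ_le_of_lt hc)
          rw [Nat.succ_eq_add_one] at this
          linarith
        · by_contra! hc
          have := Nat.mul_le_mul_left x (Nat.succ_le_of_lt hc)
          rw [Nat.succ_eq_add_one] at this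
          linarith
    · refine List.Nodup.map_on ?_ h1
      rintro ⟨i, t⟩ hp ⟨i', t'⟩ hp' heq
      have hi := ((h2 i t).1 hp).1
      have hi' := ((h2 i' t').1 hp').1
      dsimp only at heq
      have hmod : i = i' := by
        have := congrArg (· % x) heq
        simpa [Nat.mod_eq_of_lt hi, Nat.mod_eq_of_lt hi'] using this
      subst hmod
      have : t = t' := Nat.eq_of_mul_eq_mul_left (by omega : 0 < x) (by omega)
      rw [this]
  refine ⟨_, hperm, by simp [h3], ?_⟩
  have hcard := congrArg Multiset.card h5
  have hlen := hperm.length_eq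
  rw [card_linDiffs, hlen, List.length_range] at hcard
  simp only [Multiset.card_add, Multiset.card_replicate] at hcard
  rw [h5, show b' = b by omega]

lemma exists_standard_succ {s b x : ℕ}
    (h : ∃ l : List ℕ, l.Perm (List.range (s + b + 1)) ∧ l.head? = some 0 ∧
      linDiffs l = Multiset.replicate s 1 + Multiset.replicate b x) :
    ∃ l : List ℕ, l.Perm (List.range (s + 1 + b + 1)) ∧ l.head? = some 0 ∧
      linDiffs l = Multiset.replicate (s + 1) 1 + Multiset.replicate b x := by
  obtain ⟨l, h1, h2, h3⟩ := h
  refine ⟨[0] ++ l.map Nat.succ, ?_, rfl, ?_⟩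
  · rw [show s + 1 + b + 1 = (s + b + 1) + 1 by ring, List.range_succ_eq_map]
    exact (h1.map _).cons 0
  · rw [linDiffs_append (w := 0) (u := 1) rfl (by simp [h2]), linDiffs_singleton, zero_add,
      linDiffs_map_of_isometry (by simp), h3, Multiset.replicate_succ, ← Multiset.singleton_add]
    simp only [Nat.zero_sub, Nat.sub_zero, zero_add]
    abel

/-- Every `{1^x, x^b}` has a standard linear realization. -/
lemma exists_standard_self {x : ℕ} (hx : 1 ≤ x) (b : ℕ) :
    ∃ l : List ℕ, l.Perm (List.range (x + b + 1)) ∧ l.head? = some 0 ∧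
      linDiffs l = Multiset.replicate x 1 + Multiset.replicate b x := by
  obtain ⟨q, r, hr, hb⟩ : ∃ q r, r < x ∧ q * x + r = b :=
    ⟨b / x, b % x, Nat.mod_lt _ hx, Nat.div_add_mod' b x⟩
  have hM : (q + 1) * x + r = x + b := by rw [← hb]; ring
  suffices H : (∃ w, HasGridPath x (x - 1)
        (fun i t => i < x ∧ t ≤ if i < r then q + 1 else q) (0, 0) w) ∨
      (r + 1 < x ∧ ∃ w, HasGridPath x x
        (fun i t => i < x ∧ t ≤ if i < r + 1 then q + 1 else q) (0, 0) w) by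
    rcases H with ⟨w, H⟩ | ⟨hr', w, H⟩
    · obtain ⟨s, rfl⟩ : ∃ s, x = s + 1 := ⟨x - 1, by omega⟩
      exact exists_standard_succ (H.exists_standard hr (b := b) (by omega))
    · exact H.exists_standard hr' (by omega)
  rcases Nat.even_or_odd' r with ⟨ρ, rfl | rfl⟩
  · left
    rcases Nat.even_or_odd' x with ⟨p, rfl | rfl⟩
    · obtain ⟨p, rfl⟩ : ∃ p', p = p' + 1 := ⟨p - 1, by omega⟩
      refine ⟨_, (HasGridPath.snake _ 0 p (fun i => if i < 2 * ρ then q + 1 else q) ?_).congr ?_⟩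
      · intro j hj
        grind
      · grind
    · rcases p with _ | p
      · obtain rfl : ρ = 0 := by omega
        exact ⟨_, (HasGridPath.column_up _ 0 (Nat.zero_le q)).congr (by grind)⟩
      · refine ⟨_, HasGridPath.append (HasGridPath.snake _ 0 p
          (fun i => if i < 2 * ρ then q + 1 else q) ?_)
          (HasGridPath.column_up _ (2 * p + 2) (Nat.zero_le q)) ?_ ?_ ?_ ?_⟩
        · grind
        · grind
        · grind
        · simp
        · omega
  · rcases Nat.even_or_odd' x with ⟨p, rfl | rfl⟩
    · left
      refine ⟨(1, 0), ?_⟩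
      rcases p with _ | _ | p
      · omega
      · obtain rfl : ρ = 0 := by omega
        refine HasGridPath.append (HasGridPath.column_up _ 0 (Nat.zero_le (q + 1)))
          (HasGridPath.column_down _ 1 (Nat.zero_le q)) ?_ ?_ ?_ (by simp)
        · grind
        · grind
        · dsimp only
          omega
      · have hsnake := HasGridPath.snake (2 * (p + 2)) 1 p
          (fun i => if i < 2 * ρ + 1 then q + 1 else q) (by grind)
        have hrest := HasGridPath.append (n := 2 * p + 2)
          (R := fun i t => 1 ≤ i ∧ i < 2 * (p + 2) ∧ t ≤ if i < 2 * ρ + 1 then q + 1 else q)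
          hsnake (HasGridPath.column_up _ (2 * p + 3) (Nat.zero_le q)) (by grind) (by grind)
          (by grind) (by omega)
        refine HasGridPath.append (HasGridPath.column_up _ 0 (Nat.zero_le (q + 1)))
          hrest.reverse (by grind) (by grind) ?_ (by omega)
        dsimp only
        right
        ring
    · by_cases hq : q = 0
      · left
        subst hq
        obtain ⟨p, rfl⟩ : ∃ p', p = p' + 1 := ⟨p - 1, by omega⟩
        have hsnake := HasGridPath.snake (2 * (p + 1) + 1) 1 p
          (fun i => if i < 2 * ρ + 1 then 1 else 0) (by grind)
        refine ⟨_, HasGridPath.append (HasGridPath.column_up _ 0 (Nat.zero_le 1))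
          hsnake.reverse (by grind) (by grind) ?_ (by omega)⟩
        dsimp only
        omega
      · right
        refine ⟨by omega, ?_⟩
        obtain ⟨p, rfl⟩ : ∃ p', p = p' + 1 := ⟨p - 1, by omega⟩
        obtain ⟨q, rfl⟩ : ∃ q', q = q' + 1 := ⟨q - 1, by omega⟩
        set x := 2 * (p + 1) + 1 with hxdef
        set h : ℕ → ℕ := fun i => if i < 2 * ρ + 1 + 1 then q + 1 + 1 else q + 1 with hdef
        have hle : q + 1 ≤ h (2 * p) := by grind
        have h1 := HasGridPath.append (n := 1)
          (R := fun i t => (i = 2 * p ∧ t ≤ h (2 * p)) ∨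
            (i = 2 * p + 1 ∧ q + 1 ≤ t ∧ t ≤ h (2 * p)))
          (HasGridPath.column_up x (2 * p) (Nat.zero_le (h (2 * p))))
          (HasGridPath.column_down x (2 * p + 1) hle) (by omega) (by omega)
          (by dsimp only; omega) rfl
        have h2 := HasGridPath.append (n := 1)
          (R := fun i t => (i = 2 * p + 2 ∧ t ≤ q + 1) ∨ (i = 2 * p + 1 ∧ t ≤ q))
          (HasGridPath.column_down x (2 * p + 2) (Nat.zero_le (q + 1)))
          (HasGridPath.column_up x (2 * p + 1) (Nat.zero_le q)) (by omega) (by omega)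
          (by dsimp only; omega) rfl
        have h3 := HasGridPath.append (n := 3)
          (R := fun i t => 2 * p ≤ i ∧ i < x ∧ t ≤ h i)
          h1 h2 (by omega) (by grind) (by dsimp only; omega) rfl
        refine ⟨(2 * p + 1, q), ?_⟩
        rcases p with _ | p
        · exact h3.congr (by grind)
        · exact HasGridPath.append (HasGridPath.snake x 0 p h (by grind)) h3 (by grind)
            (by grind) (by dsimp only; omega) (by omega)

lemma exists_standard {x s : ℕ} (hx : 1 ≤ x) (hs : x ≤ s) (b : ℕ) :
    ∃ l : List ℕ, l.Perm (List.range (s + b + 1)) ∧ l.head? = some 0 ∧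
      linDiffs l = Multiset.replicate s 1 + Multiset.replicate b x := by
  induction s, hs using Nat.le_induction with
  | base => exact exists_standard_self hx b
  | succ s _ ih => exact exists_standard_succ ih

/-- `{1^a, x^b, y^c}` has a linear realization as soon as `a > x + y`. -/
lemma exists_linear_mset3 {x y a : ℕ} (hx : 1 ≤ x) (hy : 1 ≤ y) (ha : x + y + 1 ≤ a) (b c : ℕ) :
    ∃ l : List ℕ, l.Perm (List.range (a + b + c + 1)) ∧ linDiffs l = mset3 a b c x y := by
  obtain ⟨s, rfl⟩ := Nat.exists_eq_add_of_le' ha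
  obtain ⟨l, hl1, hl2, hl3⟩ := exists_standard_self hx b
  obtain ⟨m, hm1, hm2, hm3⟩ := exists_standard hy (Nat.le_add_left y s) c
  have hl4 : ∀ n ∈ l, n ≤ x + b := fun n hn => by
    have := hl1.mem_iff.1 hn
    rw [List.mem_range] at this
    omega
  refine ⟨(l.map fun n => x + b - n).reverse ++ m.map fun n => x + b + 1 + n, ?_, ?_⟩
  · rw [show s + (x + y + 1) + b + c + 1 = (x + b + 1) + (s + y + c + 1) by ring, List.range_add]
    refine List.Perm.append ?_ (hm1.map _)
    refine (List.reverse_perm _).trans ((hl1.map _).trans ?_)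
    rw [List.perm_ext_iff_of_nodup _ List.nodup_range]
    · intro n
      simp only [List.mem_map, List.mem_range]
      constructor
      · rintro ⟨k, hk, rfl⟩
        omega
      · intro hn
        exact ⟨x + b - n, by omega, by omega⟩
    · refine List.Nodup.map_on ?_ List.nodup_range
      intro i hi j hj hij
      rw [List.mem_range] at hi hj
      omega
  · rw [linDiffs_append (w := x + b) (u := x + b + 1) (by simp [hl2]) (by simp [hm2]),
      linDiffs_reverse, linDiffs_map_of_isometry, linDiffs_map_of_isometry, hl3, hm3, mset3,
      show x + b - (x + b + 1) + (x + b + 1 - (x + b)) = 1 by omega,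
      show s + (x + y + 1) = x + (s + y) + 1 by ring, Multiset.replicate_add (x + (s + y)),
      Multiset.replicate_add x, Multiset.replicate_one]
    · abel
    · intros
      omega
    · intro i hi j hj
      have := hl4 i hi
      have := hl4 j hj
      omega

lemma cycDiffs_cons_cons (v a b : ℕ) (l : List ℕ) :
    cycDiffs v (a :: b :: l) =
      min ((a - b) + (b - a)) (v - ((a - b) + (b - a))) ::ₘ cycDiffs v (b :: l) := by
  simp [cycDiffs]

lemma cycDiffs_eq_map (v : ℕ) (l : List ℕ) :
    cycDiffs v l = (linDiffs l).map fun d => min d (v - d) := by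
  simp [cycDiffs, linDiffs, List.map_zipWith]

lemma isRealizable_mset3 {v x y a b c : ℕ} (hx : 1 ≤ x) (hy : 1 ≤ y) (hxv : 2 * x ≤ v)
    (hyv : 2 * y ≤ v) (ha : x + y + 1 ≤ a) (hv : a + b + c + 1 = v) :
    IsRealizable v (mset3 a b c x y) := by
  obtain ⟨l, h1, h2⟩ := exists_linear_mset3 hx hy ha b c
  refine ⟨l, hv ▸ h1, ?_⟩
  rw [cycDiffs_eq_map, h2]
  conv_rhs => rw [← Multiset.map_id (mset3 a b c x y)]
  refine Multiset.map_congr rfl fun d hd => ?_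
  simp only [mset3, Multiset.mem_add, Multiset.mem_replicate] at hd
  simp only [id]
  omega

/-- The distance from `z` to `0` in the cyclic group of order `v`. -/
def zmodLength (v : ℕ) (z : ZMod v) : ℕ := z.valMinAbs.natAbs

lemma zmodLength_neg {v : ℕ} (z : ZMod v) : zmodLength v (-z) = zmodLength v z :=
  ZMod.natAbs_valMinAbs_neg z

lemma zmodLength_natCast {v n : ℕ} (h : 2 * n ≤ v) : zmodLength v (n : ZMod v) = n := by
  rw [zmodLength, ZMod.valMinAbs_natCast_of_le_half (by omega), Int.natAbs_natCast]

lemma natCast_zmodLength {v : ℕ} (z : ZMod v) :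
    (zmodLength v z : ZMod v) = z ∨ (zmodLength v z : ZMod v) = -z := by
  rcases Int.natAbs_eq z.valMinAbs with h | h
  · left
    have := congrArg (Int.cast : ℤ → ZMod v) h
    rw [ZMod.coe_valMinAbs, Int.cast_natCast] at this
    exact this.symm
  · right
    have := congrArg (Int.cast : ℤ → ZMod v) h
    rw [ZMod.coe_valMinAbs, Int.cast_neg, Int.cast_natCast] at this
    exact (neg_eq_iff_eq_neg.2 this).symm

lemma zmodLength_mul_zmodLength {v : ℕ} (u z : ZMod v) :
    zmodLength v (u * ((zmodLength v z : ℕ) : ZMod v)) = zmodLength v (u * z) := by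
  rcases natCast_zmodLength z with h | h
  · rw [h]
  · rw [h, mul_neg, zmodLength_neg]

lemma two_mul_zmodLength_le {v : ℕ} [NeZero v] (z : ZMod v) : 2 * zmodLength v z ≤ v := by
  have := ZMod.natAbs_valMinAbs_le z
  rw [zmodLength]
  omega

lemma min_absDiff_eq_zmodLength {v a b : ℕ} (ha : a < v) (hb : b < v) :
    min ((a - b) + (b - a)) (v - ((a - b) + (b - a))) = zmodLength v ((a : ZMod v) - (b : ZMod v)) := by
  have key : ∀ d : ℕ, d < v → zmodLength v (d : ZMod v) = min d (v - d) := by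
    intro d hd
    have : NeZero v := ⟨by omega⟩
    rw [zmodLength, ZMod.valMinAbs_natAbs_eq_min, ZMod.val_natCast, Nat.mod_eq_of_lt hd]
  rcases le_total a b with h | h
  · rw [← zmodLength_neg, neg_sub, ← Nat.cast_sub h, key _ (by omega)]
    simp [Nat.sub_eq_zero_of_le h]
  · rw [← Nat.cast_sub h, key _ (by omega)]
    simp [Nat.sub_eq_zero_of_le h]

/-- Multiplication by a unit of `ℤ/vℤ` preserves realizability. -/
lemma IsRealizable.mul_unit {v u : ℕ} (hv : 0 < v) (hu : u.Coprime v) {L : Multiset ℕ}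
    (h : IsRealizable v L) :
    IsRealizable v (L.map fun d : ℕ => zmodLength v ((u : ZMod v) * (d : ZMod v))) := by
  obtain ⟨l, h1, rfl⟩ := h
  refine ⟨l.map fun n => u * n % v, ?_, ?_⟩
  · refine (h1.map _).trans ?_
    have hnodup : ((List.range v).map fun n => u * n % v).Nodup := by
      refine List.Nodup.map_on ?_ List.nodup_range
      intro i hi j hj hij
      rw [List.mem_range] at hi hj
      have : i ≡ j [MOD v] := Nat.ModEq.cancel_left_of_coprime hu.symm hij
      rwa [Nat.ModEq, Nat.mod_eq_of_lt hi, Nat.mod_eq_of_lt hj] at this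
    refine (List.subperm_of_subset hnodup ?_).perm_of_length_le (by simp)
    intro n hn
    obtain ⟨k, -, rfl⟩ := List.mem_map.1 hn
    exact List.mem_range.2 (Nat.mod_lt _ hv)
  · have hl : ∀ n ∈ l, n < v := fun n hn => List.mem_range.1 (h1.mem_iff.1 hn)
    revert hl
    generalize l = m
    intro hl
    induction m with
    | nil => rfl
    | cons a l ih =>
      cases l with
      | nil => rfl
      | cons b l =>
        have := ih fun n hn => hl n (List.mem_cons_of_mem a hn)
        rw [List.map_cons] at this
        rw [List.map_cons, List.map_cons, cycDiffs_cons_cons, this, cycDiffs_cons_cons,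
          Multiset.map_cons, min_absDiff_eq_zmodLength (Nat.mod_lt _ hv) (Nat.mod_lt _ hv),
          min_absDiff_eq_zmodLength (hl a (by simp)) (hl b (by simp)), zmodLength_mul_zmodLength,
          mul_sub, ZMod.natCast_mod, ZMod.natCast_mod, Nat.cast_mul, Nat.cast_mul]

lemma map_mset3 (f : ℕ → ℕ) (a b c x y : ℕ) :
    (mset3 a b c x y).map f =
      Multiset.replicate a (f 1) + Multiset.replicate b (f x) + Multiset.replicate c (f y) := by
  simp [mset3]

lemma eq_mset3_of_toFinset {L : Multiset ℕ} {x y : ℕ} (h1x : 1 ≠ x) (h1y : 1 ≠ y) (hxy : x ≠ y)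
    (h : L.toFinset = {1, x, y}) : L = mset3 (L.count 1) (L.count x) (L.count y) x y := by
  ext n
  have hn : n ∈ L ↔ n = 1 ∨ n = x ∨ n = y := by
    rw [← Multiset.mem_toFinset, h]
    simp
  simp only [mset3, Multiset.count_add, Multiset.count_replicate]
  by_cases hL : n ∈ L
  · rcases hn.1 hL with rfl | rfl | rfl
    · simp [h1x.symm, h1y.symm]
    · simp [h1x, hxy.symm]
    · simp [h1y, hxy]
  · rw [Multiset.count_eq_zero_of_notMem hL]
    rw [hn] at hL
    push Not at hL
    simp [hL.1.symm, hL.2.1.symm, hL.2.2.symm]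

lemma card_mset3 (a b c x y : ℕ) : Multiset.card (mset3 a b c x y) = a + b + c := by
  simp [mset3]

/-- If `k * z = ±1` in `ℤ/vℤ`, then `z` and `v` are coprime. -/
lemma coprime_of_mul_eq_one_or_neg_one {v k z : ℕ}
    (h : (z : ZMod v) * k = 1 ∨ (z : ZMod v) * k = -1) : z.Coprime v := by
  rw [← ZMod.isUnit_iff_coprime]
  rcases h with h | h
  · exact IsUnit.of_mul_eq_one _ h
  · exact IsUnit.of_mul_eq_one (-(k : ZMod v)) (by rw [mul_neg, h, neg_neg])

/-- Let `x > 2` and `y > 0` with `y(x - 2) > 2x² + 2x + 1`. Then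
for all sufficiently large `v` with `v ≡ ±1 (mod xy)`, every multiset of size
`v - 1` with support `{1, x, y}` is realizable. -/
theorem stmt19 (x y : ℕ) (hx : 2 < x) (hy : 0 < y)
    (h : 2 * x ^ 2 + 2 * x + 1 < y * (x - 2)) :
    ∃ N : ℕ, ∀ v : ℕ, N ≤ v →
      (v % (x * y) = 1 ∨ v % (x * y) = x * y - 1) →
      ∀ L : Multiset ℕ, Multiset.card L = v - 1 →
        L.toFinset = {1, x, y} → IsRealizable v L := by
  have hxy : 2 * x < y := by
    by_contra! hc
    obtain ⟨t, rfl⟩ := Nat.exists_eq_add_of_lt hx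
    have : y * (2 + t + 1 - 2) ≤ 2 * (2 + t + 1) * (t + 1) := by
      rw [show 2 + t + 1 - 2 = t + 1 by omega]
      exact Nat.mul_le_mul_right _ hc
    nlinarith
  refine ⟨x * y * (x + y + 10), fun v hv hmod L hcard hsupp => ?_⟩
  obtain ⟨k, hk, hkv⟩ : ∃ k, x + y + 10 ≤ k ∧ (v = k * (x * y) + 1 ∨ v + 1 = k * (x * y)) := by
    have hdiv := Nat.div_add_mod' v (x * y)
    have hpos : 0 < x * y := by positivity
    have hq : x + y + 10 ≤ v / (x * y) := (Nat.le_div_iff_mul_le hpos).2 (by linarith)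
    rcases hmod with hmod | hmod
    · exact ⟨v / (x * y), hq, .inl (by omega)⟩
    · refine ⟨v / (x * y) + 1, by omega, .inr ?_⟩
      rw [add_mul, one_mul]
      omega
  have hv0 : 0 < v := by
    have : 0 < x * y * (x + y + 10) := by positivity
    omega
  have : NeZero v := ⟨hv0.ne'⟩
  have hkxy : ((k * (x * y) : ℕ) : ZMod v) = 1 ∨ ((k * (x * y) : ℕ) : ZMod v) = -1 := by
    rcases hkv with hkv | hkv
    · right
      rw [eq_neg_iff_add_eq_zero]
      have h0 : ((k * (x * y) + 1 : ℕ) : ZMod v) = 0 :=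
        (ZMod.natCast_eq_zero_iff _ _).2 (dvd_of_eq hkv)
      exact_mod_cast h0
    · left
      have h0 : ((v + 1 : ℕ) : ZMod v) = 1 := by simp
      rw [← hkv, h0]
  have hlen : ∀ z : ℕ, 2 * z ≤ v →
      zmodLength v (((k * (x * y) : ℕ) : ZMod v) * (z : ZMod v)) = z := by
    intro z hz
    rcases hkxy with h1 | h1
    · rw [h1, one_mul, zmodLength_natCast hz]
    · rw [h1, neg_one_mul, zmodLength_neg, zmodLength_natCast hz]
  have hkv' : k * (x * y) ≤ v + 1 ∧ v ≤ k * (x * y) + 1 := by omega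
  have hyv : 2 * y ≤ v :=
    calc 2 * y ≤ x * y := Nat.mul_le_mul_right y hx.le
      _ ≤ x * y * (x + y + 10) := Nat.le_mul_of_pos_right _ (by omega)
      _ ≤ v := hv
  have h1v : 2 * 1 ≤ v := by omega
  have hxv : 2 * x ≤ v := by omega
  rw [eq_mset3_of_toFinset (by omega) (by omega) (by omega) hsupp] at hcard ⊢
  generalize L.count 1 = a at *
  generalize L.count x = b at *
  generalize L.count y = c at *
  rw [card_mset3] at hcard
  by_cases ha : x + y + 1 ≤ a
  · exact isRealizable_mset3 (by omega) (by omega) hxv hyv ha (by omega)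
  by_cases hc : k * x + k * x ^ 2 + 1 ≤ c
  · have hu : y.Coprime v := coprime_of_mul_eq_one_or_neg_one (k := k * x) (by
      rw [← Nat.cast_mul, show y * (k * x) = k * (x * y) by ring]
      exact hkxy)
    have hle : 2 * (k * x ^ 2) ≤ v := by
      have : k * x * (2 * x + 1) ≤ k * x * y := Nat.mul_le_mul_left _ hxy
      nlinarith
    have hreal := (isRealizable_mset3 (v := v) (x := k * x) (y := k * x ^ 2) (a := c) (b := a)
      (c := b) (by nlinarith) (by nlinarith) (by nlinarith) hle hc (by omega)).mul_unit hv0 hu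
    rw [map_mset3] at hreal
    have e1 : zmodLength v ((y : ZMod v) * ((1 : ℕ) : ZMod v)) = y := by
      rw [Nat.cast_one, mul_one, zmodLength_natCast hyv]
    have e2 : zmodLength v ((y : ZMod v) * ((k * x : ℕ) : ZMod v)) = 1 := by
      rw [← hlen 1 h1v]
      push_cast
      ring_nf
    have e3 : zmodLength v ((y : ZMod v) * ((k * x ^ 2 : ℕ) : ZMod v)) = x := by
      conv_rhs => rw [← hlen x hxv]
      push_cast
      ring_nf
    rw [e1, e2, e3] at hreal
    rw [mset3]
    convert hreal using 1
    abel
  · have hu : x.Coprime v := coprime_of_mul_eq_one_or_neg_one (k := k * y) (by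
      rw [← Nat.cast_mul, show x * (k * y) = k * (x * y) by ring]
      exact hkxy)
    set w := zmodLength v ((k * y ^ 2 : ℕ) : ZMod v) with hw
    have hwv : 2 * w ≤ v := two_mul_zmodLength_le _
    have e3 : zmodLength v ((x : ZMod v) * (w : ZMod v)) = y := by
      rw [hw, zmodLength_mul_zmodLength]
      conv_rhs => rw [← hlen y hyv]
      push_cast
      ring_nf
    have hw1 : 1 ≤ w := by
      by_contra! hw0
      obtain hw0 : w = 0 := by omega
      rw [hw0, Nat.cast_zero, mul_zero] at e3
      simp only [zmodLength, ZMod.valMinAbs_zero, Int.natAbs_zero] at e3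
      omega
    have hb : k * y + w + 1 ≤ b := by
      obtain ⟨t, rfl⟩ := Nat.exists_eq_add_of_lt hx
      have h2 : 2 * (2 + t + 1) ^ 2 + 2 * (2 + t + 1) + 2 ≤ y * (t + 1) := by
        rw [show 2 + t + 1 - 2 = t + 1 by omega] at h
        exact h
      have h3 := Nat.mul_le_mul_left k h2
      have hcard' : a + b + c + 1 = v := by omega
      obtain ⟨hlow, -⟩ := hkv'
      push Not at ha hc
      ring_nf at h3 hlow hc ha hk ⊢
      omega
    have hkpos : 1 ≤ k * y := Nat.mul_pos (by omega) hy
    have hkyv : 2 * (k * y) ≤ v := by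
      have : 3 * (k * y) ≤ x * (k * y) := Nat.mul_le_mul_right _ hx
      rw [show x * (k * y) = k * (x * y) by ring] at this
      omega
    have hreal := (isRealizable_mset3 (v := v) (x := k * y) (y := w) (a := b) (b := a)
      (c := c) hkpos hw1 hkyv hwv hb (by omega)).mul_unit hv0 hu
    rw [map_mset3] at hreal
    have e1 : zmodLength v ((x : ZMod v) * ((1 : ℕ) : ZMod v)) = x := by
      rw [Nat.cast_one, mul_one, zmodLength_natCast hxv]
    have e2 : zmodLength v ((x : ZMod v) * ((k * y : ℕ) : ZMod v)) = 1 := by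
      rw [← hlen 1 h1v]
      push_cast
      ring_nf
    rw [e1, e2, e3] at hreal
    rw [mset3]
    convert hreal using 1
    abel
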